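/- arXiv:1003.3280 — 4 statements merged into one kernel-verified Lean document; each statement's English description precedes it below -/
import Mathlib

section
/- Let I⊆ℝ be an interval, ħ>0, x₁∈I, and p:I→(0,∞) continuously differentiable. Set θ(x) = (1/ħ)∫_{x₁}^{x} p(y)dy. Let ζ:I→ℂ be twice differentiable with ħ²ζ''(x) + p(x)²ζ(x) = 0. Define c₁(x) = e^{iθ(x)}(√(p(x))·ζ(x) + iħζ'(x)/√(p(x)))/2 and c₂(x) = e^{−iθ(x)}(√(p(x))·ζ(x) − iħζ'(x)/√(p(x)))/2. Then ζ(x) = c₁(x)e^{−iθ(x)}p(x)^{−1/2} + c₂(x)e^{iθ(x)}p(x)^{−1/2} for all x∈I, and c₁,c₂ are differentiable with c₁'(x) = (p'(x)/(2p(x)))e^{2iθ(x)}c₂(x) and c₂'(x) = (p'(x)/(2p(x)))e^{−2iθ(x)}c₁(x). -/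
open Complex intervalIntegral

/-- The fundamental theorem of calculus relative to a convex set: on a convex set `s`, the integral
of a function continuous on `s` is a primitive within `s`, endpoints included. -/
theorem ContinuousOn.hasDerivWithinAt_integral_of_convex {E : Type*} [NormedAddCommGroup E]
    [NormedSpace ℝ E] [CompleteSpace E] {s : Set ℝ} (hs : Convex ℝ s) {f : ℝ → E}
    (hf : ContinuousOn f s) {a x : ℝ} (ha : a ∈ s) (hx : x ∈ s) :
    HasDerivWithinAt (fun u => ∫ y in a..u, f y) (f x) s x := by
  have hint : ∀ u ∈ s, ∀ v ∈ s, IntervalIntegrable f MeasureTheory.volume u v := fun u hu v hv =>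
    (hf.mono (hs.ordConnected.uIcc_subset hu hv)).intervalIntegrable
  rw [hasDerivWithinAt_iff_isLittleO, Asymptotics.isLittleO_iff]
  intro ε hε
  obtain ⟨δ, hδ, hfδ⟩ := Metric.continuousWithinAt_iff.1 (hf x hx) ε hε
  filter_upwards [self_mem_nhdsWithin, mem_nhdsWithin_of_mem_nhds (Metric.ball_mem_nhds x hδ)]
    with y hy hyδ
  have hdiff : (∫ t in a..y, f t) - (∫ t in a..x, f t) - (y - x) • f x
      = ∫ t in x..y, (f t - f x) := by
    rw [integral_interval_sub_left (hint a ha y hy) (hint a ha x hx),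
      integral_sub (hint x hx y hy) intervalIntegrable_const, integral_const]
  rw [hdiff, Real.norm_eq_abs]
  refine norm_integral_le_of_norm_le_const fun t ht => ?_
  have ht' := Set.uIoc_subset_uIcc ht
  rw [← dist_eq_norm]
  refine (hfδ (hs.ordConnected.uIcc_subset hx hy ht') ?_).le
  rw [Real.dist_eq]
  refine (Set.abs_sub_left_of_mem_uIcc ht').trans_lt ?_
  rwa [Metric.mem_ball, Real.dist_eq] at hyδ

/-- One WKB amplitude, for either sign `σ = ± i`: if `q = √p`, `θ' = p / ħ` and
`ħ² ζ'' + p² ζ = 0`, then `c = e^{σθ} (q ζ + σ ħ ζ' / q) / 2` satisfies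
`c' = (p' / 2p) e^{σθ} (q ζ - σ ħ ζ' / q) / 2`. -/
theorem hasDerivWithinAt_wkb_amplitude {s : Set ℝ} {x p' : ℝ} {hbar : ℝ} (hhb : hbar ≠ 0)
    {σ : ℂ} (hσ : σ ^ 2 = -1) {p θ : ℝ → ℝ} {ζ ζ' : ℝ → ℂ} {ζ'' : ℂ} (hpos : 0 < p x)
    (hp : HasDerivWithinAt p p' s x) (hθ : HasDerivWithinAt θ (p x / hbar) s x)
    (hζ : HasDerivWithinAt ζ (ζ' x) s x) (hζ' : HasDerivWithinAt ζ' ζ'' s x)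
    (hode : (hbar : ℂ) ^ 2 * ζ'' + (p x : ℂ) ^ 2 * ζ x = 0) :
    HasDerivWithinAt
      (fun y => Complex.exp (σ * (θ y : ℂ)) *
        ((Real.sqrt (p y) : ℂ) * ζ y + σ * (hbar : ℂ) * ζ' y / (Real.sqrt (p y) : ℂ)) / 2)
      (((p' / (2 * p x) : ℝ) : ℂ) * (Complex.exp (σ * (θ x : ℂ)) *
        ((Real.sqrt (p x) : ℂ) * ζ x - σ * (hbar : ℂ) * ζ' x / (Real.sqrt (p x) : ℂ)) / 2)) s x := by
  have hq := (hp.sqrt hpos.ne').ofReal_comp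
  have hq0 : (Real.sqrt (p x) : ℂ) ≠ 0 := by exact_mod_cast (Real.sqrt_pos.2 hpos).ne'
  have hb : (hbar : ℂ) ≠ 0 := by exact_mod_cast hhb
  have hsq : (p x : ℂ) = (Real.sqrt (p x) : ℂ) ^ 2 := by
    exact_mod_cast (Real.sq_sqrt hpos.le).symm
  have hζ'' : ζ'' = -(p x : ℂ) ^ 2 * ζ x / (hbar : ℂ) ^ 2 := by
    field_simp
    linear_combination hode
  have hexp := (hθ.ofReal_comp.const_mul σ).cexp
  refine ((hexp.mul ((hq.mul hζ).add ((hζ'.const_mul (σ * hbar)).div hq hq0))).div_const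
    2).congr_deriv ?_
  simp only [Pi.add_apply, Pi.mul_apply, Pi.div_apply]
  push_cast
  rw [hζ'', hsq]
  generalize (Real.sqrt (p x) : ℂ) = q at *
  field_simp
  linear_combination (2 * q ^ 4 * hbar * ζ' x) * hσ

/-- Reduction of the stationary Schrödinger equation `-hbar²ζ'' = p²ζ` to the
first-order WKB coefficient system: with `θ(x) = (1/hbar)∫_{x₁}^x p`,
`c₁ = e^{iθ}(√p ζ + ihbarζ'/√p)/2` and `c₂ = e^{-iθ}(√p ζ - ihbarζ'/√p)/2`,
one has `ζ = c₁ e^{-iθ} p^{-1/2} + c₂ e^{iθ} p^{-1/2}` and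
`c₁' = (p'/(2p)) e^{2iθ} c₂`, `c₂' = (p'/(2p)) e^{-2iθ} c₁`. -/
theorem wkb_reduction
    (I : Set ℝ) (hI : Convex ℝ I) (hbar : ℝ) (hhb : 0 < hbar)
    (x₁ : ℝ) (hx₁ : x₁ ∈ I)
    (p p' : ℝ → ℝ) (hppos : ∀ x ∈ I, 0 < p x)
    (hp : ∀ x ∈ I, HasDerivWithinAt p (p' x) I x)
    (hp' : ContinuousOn p' I)
    (ζ ζ' ζ'' : ℝ → ℂ)
    (hζ : ∀ x ∈ I, HasDerivWithinAt ζ (ζ' x) I x)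
    (hζ' : ∀ x ∈ I, HasDerivWithinAt ζ' (ζ'' x) I x)
    (hode : ∀ x ∈ I, (hbar : ℂ) ^ 2 * ζ'' x + (p x : ℂ) ^ 2 * ζ x = 0)
    (θ : ℝ → ℝ) (hθ : ∀ x, θ x = (1 / hbar) * ∫ y in x₁..x, p y)
    (c₁ c₂ : ℝ → ℂ)
    (hc₁def : ∀ x, c₁ x = Complex.exp (Complex.I * (θ x : ℂ)) *
      ((Real.sqrt (p x) : ℂ) * ζ x + Complex.I * (hbar : ℂ) * ζ' x / (Real.sqrt (p x) : ℂ)) / 2)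
    (hc₂def : ∀ x, c₂ x = Complex.exp (-Complex.I * (θ x : ℂ)) *
      ((Real.sqrt (p x) : ℂ) * ζ x - Complex.I * (hbar : ℂ) * ζ' x / (Real.sqrt (p x) : ℂ)) / 2) :
    (∀ x ∈ I, ζ x = c₁ x * Complex.exp (-Complex.I * (θ x : ℂ)) * ((Real.sqrt (p x) : ℂ))⁻¹
        + c₂ x * Complex.exp (Complex.I * (θ x : ℂ)) * ((Real.sqrt (p x) : ℂ))⁻¹)
    ∧ (∀ x ∈ I, HasDerivWithinAt c₁
        (((p' x / (2 * p x) : ℝ) : ℂ) * Complex.exp (2 * Complex.I * (θ x : ℂ)) * c₂ x) I x)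
    ∧ (∀ x ∈ I, HasDerivWithinAt c₂
        (((p' x / (2 * p x) : ℝ) : ℂ) * Complex.exp (-2 * Complex.I * (θ x : ℂ)) * c₁ x) I x) := by
  have hq0 : ∀ x ∈ I, (Real.sqrt (p x) : ℂ) ≠ 0 := fun x hx => by
    exact_mod_cast (Real.sqrt_pos.2 (hppos x hx)).ne'
  have hθ' : ∀ x ∈ I, HasDerivWithinAt θ (p x / hbar) I x := fun x hx => by
    have hcont : ContinuousOn p I := fun y hy => (hp y hy).continuousWithinAt
    rw [funext hθ]
    exact ((hcont.hasDerivWithinAt_integral_of_convex hI hx₁ hx).const_mul (1 / hbar)).congr_deriv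
      (by ring)
  have hexp : ∀ x, Complex.exp (Complex.I * (θ x : ℂ)) * Complex.exp (-Complex.I * (θ x : ℂ)) = 1 :=
    fun x => by rw [← Complex.exp_add, neg_mul, add_neg_cancel, Complex.exp_zero]
  refine ⟨fun x hx => ?_, fun x hx => ?_, fun x hx => ?_⟩
  · have hq := hq0 x hx
    rw [hc₁def, hc₂def]
    have h1 := hexp x
    rw [neg_mul] at h1 ⊢
    field_simp
    linear_combination (-2 * (Real.sqrt (p x) : ℂ) ^ 2 * ζ x) * h1
  · rw [funext hc₁def, hc₂def]
    refine (hasDerivWithinAt_wkb_amplitude hhb.ne' (by simp) (hppos x hx) (hp x hx) (hθ' x hx)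
      (hζ x hx) (hζ' x hx) (hode x hx)).congr_deriv ?_
    have h2 : Complex.exp (2 * Complex.I * (θ x : ℂ)) = Complex.exp (Complex.I * (θ x : ℂ)) ^ 2 := by
      rw [← Complex.exp_nat_mul]; push_cast; ring_nf
    rw [h2]
    linear_combination (-((p' x / (2 * p x) : ℝ) : ℂ) * Complex.exp (Complex.I * (θ x : ℂ)) *
      ((Real.sqrt (p x) : ℂ) * ζ x - Complex.I * (hbar : ℂ) * ζ' x / (Real.sqrt (p x) : ℂ)) / 2) *
        hexp x
  · rw [funext hc₂def, hc₁def]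
    have hamp := hasDerivWithinAt_wkb_amplitude (σ := -Complex.I) hhb.ne' (by simp) (hppos x hx)
      (hp x hx) (hθ' x hx) (hζ x hx) (hζ' x hx) (hode x hx)
    simp only [neg_mul, neg_div, ← sub_eq_add_neg, sub_neg_eq_add] at hamp ⊢
    refine hamp.congr_deriv ?_
    have h2 : Complex.exp (-(2 * Complex.I * (θ x : ℂ))) =
        Complex.exp (-(Complex.I * (θ x : ℂ))) ^ 2 := by
      rw [← Complex.exp_nat_mul]; push_cast; ring_nf
    have h1 := hexp x
    rw [neg_mul] at h1
    rw [h2]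
    linear_combination (-((p' x / (2 * p x) : ℝ) : ℂ) * Complex.exp (-(Complex.I * (θ x : ℂ))) *
      ((Real.sqrt (p x) : ℂ) * ζ x + Complex.I * (hbar : ℂ) * ζ' x / (Real.sqrt (p x) : ℂ)) / 2) *
        h1
end

section
/- Let ħ>0, k*∈ℝ, E*∈ℝ, κ₀,κ₁∈ℝ, C₀∈ℂ, and A∈ℂ with Re A > 0. Define χ(x,t) = C₀·(A+it)^{−1/2}·exp{−i(tE* + κ₀ − k*x)/ħ}·exp{−(x − k*(t+κ₁))²/(2ħ(A+it))} (principal square root). Then for every t∈ℝ, the L²(ℝ)-norm of χ(·,t) equals |C₀|·(πħ)^{1/4}·(Re A)^{−1/4}; in particular it is independent of t. Consequently, with C₀ = √(2πħk*)·P·e^{−α*/ħ}·√(p₋/p₊) (k*>0, p₋,p₊>0, α*≥0, P∈ℂ) and Re A = α₂ > 0, the norm equals ħ^{3/4}·π^{3/4}·√(2k*)·e^{−α*/ħ}·|P|·√(p₋/p₊)·α₂^{−1/4}, which is O(ħ^{3/4}e^{−α*/ħ}). -/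
open Complex MeasureTheory

/-- The norm of the principal power `z ^ (-1/2)` squares to `‖z‖⁻¹`. -/
lemma norm_cpow_neg_half_sq (z : ℂ) : ‖z ^ (-(1 / 2) : ℂ)‖ ^ 2 = ‖z‖⁻¹ := by
  have h : (-(1 / 2) : ℂ) = ((-(1 / 2) : ℝ) : ℂ) := by push_cast; ring
  rw [h, Complex.norm_cpow_real, ← Real.rpow_natCast, ← Real.rpow_mul (norm_nonneg z),
    ← Real.rpow_neg_one]
  norm_num

lemma norm_exp_neg_I_mul_ofReal_div (r s : ℝ) : ‖Complex.exp (-I * (r : ℂ) / (s : ℂ))‖ = 1 := by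
  have h : -I * (r : ℂ) / (s : ℂ) = ((-(r / s) : ℝ) : ℂ) * I := by push_cast; ring
  rw [h, Complex.norm_exp_ofReal_mul_I]

/-- The squared modulus of a complex Gaussian of complex width `z` is a real Gaussian. -/
lemma norm_exp_neg_sq_div_sq {h : ℝ} (y : ℝ) (z : ℂ) :
    ‖Complex.exp (-(y : ℂ) ^ 2 / (2 * (h : ℂ) * z))‖ ^ 2
      = Real.exp (-(z.re / (h * ‖z‖ ^ 2)) * y ^ 2) := by
  have e : -(y : ℂ) ^ 2 / (2 * (h : ℂ) * z) = ((-(y ^ 2 / (2 * h)) : ℝ) : ℂ) * z⁻¹ := by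
    push_cast
    simp only [div_eq_mul_inv, mul_inv]
    ring
  rw [e, Complex.norm_exp, ← Real.exp_nat_mul, Complex.re_ofReal_mul, Complex.inv_re,
    Complex.normSq_eq_norm_sq]
  congr 1
  simp only [div_eq_mul_inv, mul_inv]
  push_cast
  ring

/-- The integral of the squared modulus of a Gaussian of complex width, normalised by the
reciprocal of the modulus of the width, depends only on the real part of the width. -/
lemma integral_inv_norm_mul_gaussian {h : ℝ} {z : ℂ} (hz : 0 < z.re) (c : ℝ) :
    ∫ x : ℝ, ‖z‖⁻¹ * Real.exp (-(z.re / (h * ‖z‖ ^ 2)) * (x - c) ^ 2)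
      = Real.sqrt (Real.pi * h / z.re) := by
  have hn : 0 < ‖z‖ := norm_pos_iff.mpr fun h0 => by simp [h0] at hz
  rw [integral_const_mul,
    integral_sub_right_eq_self (fun x : ℝ => Real.exp (-(z.re / (h * ‖z‖ ^ 2)) * x ^ 2)) c,
    integral_gaussian]
  have e : Real.pi / (z.re / (h * ‖z‖ ^ 2)) = ‖z‖ ^ 2 * (Real.pi * h / z.re) := by
    rw [div_div_eq_mul_div]
    ring
  rw [e, Real.sqrt_mul (sq_nonneg _), Real.sqrt_sq hn.le, inv_mul_cancel_left₀ hn.ne']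

lemma sq_mul_sqrt_div_rpow_half {c b a : ℝ} (hc : 0 ≤ c) (hb : 0 ≤ b) (ha : 0 < a) :
    (c ^ 2 * Real.sqrt (b / a)) ^ ((1 : ℝ) / 2)
      = c * b ^ ((1 : ℝ) / 4) * a ^ (-(1 : ℝ) / 4) := by
  rw [Real.mul_rpow (sq_nonneg c) (Real.sqrt_nonneg _), ← Real.sqrt_eq_rpow, Real.sqrt_sq hc,
    Real.sqrt_eq_rpow (b / a), ← Real.rpow_mul (div_nonneg hb ha.le), Real.div_rpow hb ha.le,
    neg_div, Real.rpow_neg ha.le]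
  norm_num
  ring

lemma sqrt_mul_rpow_quarter {h k : ℝ} (hh : 0 < h) :
    Real.sqrt (2 * Real.pi * h * k) * (Real.pi * h) ^ ((1 : ℝ) / 4)
      = h ^ ((3 : ℝ) / 4) * Real.pi ^ ((3 : ℝ) / 4) * Real.sqrt (2 * k) := by
  have hp : 0 < Real.pi * h := mul_pos Real.pi_pos hh
  have e : 2 * Real.pi * h * k = Real.pi * h * (2 * k) := by ring
  rw [e, Real.sqrt_mul hp.le, mul_right_comm, Real.sqrt_eq_rpow (Real.pi * h),
    ← Real.rpow_add hp, ← Real.mul_rpow hh.le Real.pi_pos.le, mul_comm h]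
  norm_num

/-- L² norm of the leading Gaussian term `χ_Gauss^∞` of Theorem 1:
`‖χ(·,t)‖_{L²(ℝ)} = |C₀| (πħ)^{1/4} (Re A)^{-1/4}` for every `t` (so it is
independent of `t`), and with
`C₀ = √(2πħk*) P e^{-α*/ħ} √(p₋/p₊)` and `Re A = α₂` this equals
`ħ^{3/4} π^{3/4} √(2k*) e^{-α*/ħ} |P| √(p₋/p₊) α₂^{-1/4}`, which is
`O(ħ^{3/4} e^{-α*/ħ})`. -/
theorem gaussian_l2_norm
    (hbar : ℝ) (hhb : 0 < hbar) (kstar Estar κ₀ κ₁ : ℝ)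
    (C₀ A : ℂ) (hA : 0 < A.re)
    (χ : ℝ → ℝ → ℂ)
    (hχ : ∀ x t : ℝ, χ x t = C₀ * (A + Complex.I * (t : ℂ)) ^ (-(1 / 2) : ℂ)
      * Complex.exp (-Complex.I * ((t * Estar + κ₀ - kstar * x : ℝ) : ℂ) / (hbar : ℂ))
      * Complex.exp (-((x - kstar * (t + κ₁) : ℝ) : ℂ) ^ 2
          / (2 * (hbar : ℂ) * (A + Complex.I * (t : ℂ)))))
    (kpos : 0 < kstar) (pminus pplus : ℝ) (hpm : 0 < pminus) (hpp : 0 < pplus)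
    (αstar : ℝ) (hαstar : 0 ≤ αstar) (P : ℂ) (α₂ : ℝ)
    (hC₀ : C₀ = (Real.sqrt (2 * Real.pi * hbar * kstar) : ℂ) * P
        * Complex.exp (-(αstar : ℂ) / (hbar : ℂ)) * (Real.sqrt (pminus / pplus) : ℂ))
    (hα₂ : A.re = α₂) :
    (∀ t : ℝ, (∫ x : ℝ, ‖χ x t‖ ^ 2) ^ ((1 : ℝ) / 2)
        = ‖C₀‖ * (Real.pi * hbar) ^ ((1 : ℝ) / 4) * A.re ^ (-(1 : ℝ) / 4))
    ∧ (∀ t : ℝ, (∫ x : ℝ, ‖χ x t‖ ^ 2) ^ ((1 : ℝ) / 2)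
        = hbar ^ ((3 : ℝ) / 4) * Real.pi ^ ((3 : ℝ) / 4) * Real.sqrt (2 * kstar)
          * Real.exp (-αstar / hbar) * ‖P‖ * Real.sqrt (pminus / pplus)
          * α₂ ^ (-(1 : ℝ) / 4)) := by
  have hfirst : ∀ t : ℝ, (∫ x : ℝ, ‖χ x t‖ ^ 2) ^ ((1 : ℝ) / 2)
      = ‖C₀‖ * (Real.pi * hbar) ^ ((1 : ℝ) / 4) * A.re ^ (-(1 : ℝ) / 4) := by
    intro t
    have hre : (A + I * (t : ℂ)).re = A.re := by simp
    have hz : 0 < (A + I * (t : ℂ)).re := by rwa [hre]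
    have hint : ∫ x : ℝ, ‖χ x t‖ ^ 2 = ‖C₀‖ ^ 2 * Real.sqrt (Real.pi * hbar / A.re) := by
      rw [← hre, ← integral_inv_norm_mul_gaussian hz (kstar * (t + κ₁)), ← integral_const_mul]
      congr 1 with x
      rw [hχ, norm_mul, norm_mul, norm_mul, mul_pow, mul_pow, mul_pow,
        norm_cpow_neg_half_sq, norm_exp_neg_I_mul_ofReal_div, norm_exp_neg_sq_div_sq]
      ring
    rw [hint, sq_mul_sqrt_div_rpow_half (norm_nonneg _) (mul_pos Real.pi_pos hhb).le hA]
  refine ⟨hfirst, fun t => ?_⟩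
  have hnorm : ‖C₀‖ = Real.sqrt (2 * Real.pi * hbar * kstar) * ‖P‖ * Real.exp (-αstar / hbar)
      * Real.sqrt (pminus / pplus) := by
    have e : -(αstar : ℂ) / (hbar : ℂ) = ((-αstar / hbar : ℝ) : ℂ) := by push_cast; rfl
    rw [hC₀, e, norm_mul, norm_mul, norm_mul, Complex.norm_exp_ofReal,
      Complex.norm_of_nonneg (Real.sqrt_nonneg _), Complex.norm_of_nonneg (Real.sqrt_nonneg _)]
  rw [hfirst t, hnorm, hα₂, ← sqrt_mul_rpow_quarter hhb]
  ring
end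

section
/- Let j∈ℕ, let H be a real polynomial of degree j with leading coefficient h_j ≠ 0, and let α>0 and η∈ℝ. Then there is a constant C such that for all ħ∈(0,1]: (∫_ℝ |H((k−η)/√ħ) − h_j·α^j·ħ^{−j/2}|²·e^{−(k−η−α)²/ħ} dk)^{1/2} ≤ C·ħ^{3/4−j/2}. Since the L²(ℝ)-norm of k ↦ h_j·α^j·ħ^{−j/2}·e^{−(k−η−α)²/(2ħ)} equals |h_j|·α^j·ħ^{−j/2}·(πħ)^{1/4}, the relative L² error is O(ħ^{1/2}); i.e., the function k ↦ H((k−η)/√ħ)·e^{−(k−η−α)²/(2ħ)} is asymptotically a Gaussian centered at η+α as ħ→0. -/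
open MeasureTheory Polynomial

theorem integrable_eval_mul_exp_neg_sq (p : ℝ[X]) :
    Integrable fun y : ℝ => p.eval y * Real.exp (-y ^ 2) := by
  have hmono (n : ℕ) : Integrable fun y : ℝ => y ^ n * Real.exp (-y ^ 2) := by
    have h := integrable_rpow_mul_exp_neg_mul_sq (b := 1) one_pos (s := (n : ℝ))
      (by linarith [n.cast_nonneg (α := ℝ)])
    simpa [Real.rpow_natCast] using h
  simp only [eval_eq_sum_range, Finset.sum_mul, mul_assoc]
  exact integrable_finsetSum _ fun i _ => (hmono i).const_mul _

/-- Near `α / s` with `s` small, a polynomial is its leading term up to a relative error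
of order `s`, with a constant growing polynomially in the displacement `y`. -/
theorem exists_abs_pow_mul_eval_sub_le (p : ℝ[X]) {α : ℝ} (hα : 0 < α) :
    ∃ K : ℝ, ∀ s ∈ Set.Ioc (0 : ℝ) 1, ∀ y : ℝ,
      |s ^ p.natDegree * p.eval (α / s + y) - p.leadingCoeff * α ^ p.natDegree| ≤
        K * s * ((α + 1) * (1 + y ^ 2)) ^ p.natDegree := by
  set n := p.natDegree with hn
  refine ⟨(∑ i ∈ Finset.range n, |p.coeff i|) + |p.leadingCoeff| * n, ?_⟩
  rintro s ⟨hs0, hs1⟩ y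
  set M := (α + 1) * (1 + y ^ 2) with hM
  have hy : |y| ≤ 1 + y ^ 2 := by
    rw [abs_le]; constructor <;> nlinarith [sq_nonneg (y - 1), sq_nonneg (y + 1)]
  have hyM : |y| ≤ M := by nlinarith [mul_nonneg hα.le (sq_nonneg y)]
  have hM1 : 1 ≤ M := by nlinarith [mul_nonneg hα.le (sq_nonneg y), sq_nonneg y]
  have hαM : |α| ≤ M := by
    rw [abs_of_pos hα]; nlinarith [mul_nonneg hα.le (sq_nonneg y), sq_nonneg y]
  have hsyM : |α + s * y| ≤ M := by
    have h1 : |s * y| ≤ |y| := by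
      rw [abs_mul, abs_of_pos hs0]; exact mul_le_of_le_one_left (abs_nonneg y) hs1
    have h2 := abs_add_le α (s * y)
    rw [abs_of_pos hα] at h2
    nlinarith [mul_nonneg hα.le (sq_nonneg y)]
  have hexp : s ^ n * p.eval (α / s + y) - p.leadingCoeff * α ^ n =
      (∑ i ∈ Finset.range n, p.coeff i * (s ^ (n - i) * (α + s * y) ^ i)) +
        p.leadingCoeff * ((α + s * y) ^ n - α ^ n) := by
    have hz : α + s * y = s * (α / s + y) := by field_simp
    rw [eval_eq_sum_range, ← hn, Finset.sum_range_succ, mul_add, Finset.mul_sum, hz]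
    have : ∀ i ∈ Finset.range n, s ^ n * (p.coeff i * (α / s + y) ^ i) =
        p.coeff i * (s ^ (n - i) * (s * (α / s + y)) ^ i) := fun i hi => by
      rw [← Nat.sub_add_cancel (Finset.mem_range.1 hi).le, pow_add, Nat.add_sub_cancel, mul_pow]
      ring
    rw [Finset.sum_congr rfl this, mul_pow s _ n, leadingCoeff, ← hn]
    ring
  have hlow : ∀ i ∈ Finset.range n,
      |p.coeff i * (s ^ (n - i) * (α + s * y) ^ i)| ≤ |p.coeff i| * (s * M ^ n) := fun i hi => by
    rw [Finset.mem_range] at hi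
    rw [abs_mul, abs_mul, abs_pow, abs_pow, abs_of_pos hs0]
    gcongr
    · exact pow_le_of_le_one hs0.le hs1 (by omega)
    · exact (pow_le_pow_left₀ (abs_nonneg _) hsyM i).trans (pow_le_pow_right₀ hM1 hi.le)
  have htop : |(α + s * y) ^ n - α ^ n| ≤ n * (s * M ^ n) := by
    refine (abs_pow_sub_pow_le _ _ n).trans ?_
    rw [add_sub_cancel_left, abs_mul, abs_of_pos hs0]
    rcases Nat.eq_zero_or_pos n with h0 | hpos
    · simp [h0]
    · calc s * |y| * n * max |α + s * y| |α| ^ (n - 1) ≤ s * M * n * M ^ (n - 1) := by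
            gcongr
            exact max_le hsyM hαM
        _ = n * (s * M ^ n) := by
            rw [← Nat.sub_add_cancel hpos, pow_succ, Nat.add_sub_cancel]; ring
  rw [hexp]
  calc _ ≤ (∑ i ∈ Finset.range n, |p.coeff i| * (s * M ^ n)) +
        |p.leadingCoeff| * (n * (s * M ^ n)) := by
        refine (abs_add_le _ _).trans (add_le_add ?_ ?_)
        · exact (Finset.abs_sum_le_sum_abs _ _).trans (Finset.sum_le_sum hlow)
        · rw [abs_mul]; gcongr
    _ = _ := by rw [← Finset.sum_mul]; ring

theorem rpow_neg_natCast_div_two {x : ℝ} (hx : 0 < x) (n : ℕ) :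
    x ^ (-(n : ℝ) / 2) = (Real.sqrt x ^ n)⁻¹ := by
  rw [Real.sqrt_eq_rpow, ← Real.rpow_natCast, ← Real.rpow_mul hx.le, ← Real.rpow_neg hx.le]
  congr 1; ring

/-- A polynomial of degree `j` times a Gaussian shifted by `α > 0` is
asymptotically a Gaussian: the polynomial factor may be replaced by its leading
term `h_j α^j ħ^{-j/2}` up to an error of order `ħ^{3/4-j/2}` in `L²`, while the
leading Gaussian `k ↦ h_j α^j ħ^{-j/2} e^{-(k-η-α)²/(2ħ)}` has `L²` norm
`|h_j| α^j ħ^{-j/2} (πħ)^{1/4}`. -/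
theorem hermite_times_shifted_gaussian_is_asymptotically_gaussian
    (j : ℕ) (H : Polynomial ℝ) (hdeg : H.natDegree = j)
    (hlead : H.leadingCoeff ≠ 0)
    (α η : ℝ) (hα : 0 < α) :
    (∃ C : ℝ, ∀ hbar ∈ Set.Ioc (0 : ℝ) 1,
      (∫ k : ℝ, |H.eval ((k - η) / Real.sqrt hbar)
            - H.leadingCoeff * α ^ j * hbar ^ (-(j : ℝ) / 2)| ^ 2
          * Real.exp (-(k - η - α) ^ 2 / hbar)) ^ ((1 : ℝ) / 2)
        ≤ C * hbar ^ ((3 : ℝ) / 4 - (j : ℝ) / 2))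
    ∧ (∀ hbar ∈ Set.Ioc (0 : ℝ) 1,
      (∫ k : ℝ, |H.leadingCoeff * α ^ j * hbar ^ (-(j : ℝ) / 2)
            * Real.exp (-(k - η - α) ^ 2 / (2 * hbar))| ^ 2) ^ ((1 : ℝ) / 2)
        = |H.leadingCoeff| * α ^ j * hbar ^ (-(j : ℝ) / 2)
            * (Real.pi * hbar) ^ ((1 : ℝ) / 4)) := by
  constructor
  · subst hdeg
    set n := H.natDegree
    obtain ⟨K, hK⟩ := exists_abs_pow_mul_eval_sub_le H hα
    set G : ℝ → ℝ := fun y => ((α + 1) * (1 + y ^ 2)) ^ (2 * n) * Real.exp (-y ^ 2)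
    have hG : Integrable G := by
      refine (integrable_eval_mul_exp_neg_sq ((C (α + 1) * (1 + X ^ 2)) ^ (2 * n))).congr
        (.of_forall fun y => ?_)
      simp only [G, eval_pow, eval_mul, eval_add, eval_C, eval_one, eval_X]
    refine ⟨Real.sqrt (K ^ 2 * ∫ y, G y), ?_⟩
    rintro hbar ⟨h0, h1⟩
    set s := Real.sqrt hbar with hs
    have hs0 : 0 < s := Real.sqrt_pos.2 h0
    have hs1 : s ≤ 1 := Real.sqrt_le_one.2 h1
    have hss : s ^ 2 = hbar := Real.sq_sqrt h0.le
    set c := K ^ 2 * s ^ 2 * ((s ^ n)⁻¹) ^ 2 with hc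
    have hpt (k : ℝ) : |H.eval ((k - η) / s) - H.leadingCoeff * α ^ n * hbar ^ (-(n : ℝ) / 2)| ^ 2
        * Real.exp (-(k - η - α) ^ 2 / hbar) ≤ c * G ((k - (η + α)) / s) := by
      set y := (k - (η + α)) / s with hy
      have hk : (k - η) / s = α / s + y := by rw [hy]; ring
      have he : -(k - η - α) ^ 2 / hbar = -y ^ 2 := by
        rw [hy, ← hss]; ring
      have hb : |H.eval (α / s + y) - H.leadingCoeff * α ^ n * (s ^ n)⁻¹| ≤
          (s ^ n)⁻¹ * (K * s * ((α + 1) * (1 + y ^ 2)) ^ n) := by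
        have hsn : 0 < (s ^ n)⁻¹ := by positivity
        calc _ = (s ^ n)⁻¹ * |s ^ n * H.eval (α / s + y) - H.leadingCoeff * α ^ n| := by
              rw [← abs_of_pos hsn, ← abs_mul, abs_of_pos hsn]
              congr 1
              field_simp
          _ ≤ _ := mul_le_mul_of_nonneg_left (hK s ⟨hs0, hs1⟩ y) hsn.le
      rw [rpow_neg_natCast_div_two h0, ← hs, hk, he]
      calc _ ≤ ((s ^ n)⁻¹ * (K * s * ((α + 1) * (1 + y ^ 2)) ^ n)) ^ 2 * Real.exp (-y ^ 2) := by
            gcongr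
        _ = c * G y := by simp only [hc, G]; ring
    have hint : Integrable fun k : ℝ => G ((k - (η + α)) / s) :=
      (hG.comp_div hs0.ne').comp_sub_right (η + α)
    have hval : ∫ k : ℝ, G ((k - (η + α)) / s) = s * ∫ y, G y := by
      rw [integral_sub_right_eq_self (fun k => G (k / s)), Measure.integral_comp_div,
        abs_of_pos hs0, smul_eq_mul]
    have hpow : (hbar ^ ((3 : ℝ) / 4 - (n : ℝ) / 2)) ^ 2 = s ^ 3 * ((s ^ n)⁻¹) ^ 2 := by
      rw [sub_eq_add_neg, ← neg_div, Real.rpow_add h0, rpow_neg_natCast_div_two h0, mul_pow,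
        ← Real.rpow_natCast (hbar ^ _), ← Real.rpow_mul h0.le, hs, Real.sqrt_eq_rpow,
        ← Real.rpow_natCast (hbar ^ _) 3, ← Real.rpow_mul h0.le]
      norm_num
    rw [← Real.sqrt_eq_rpow]
    calc _ ≤ Real.sqrt ((K ^ 2 * ∫ y, G y) * (hbar ^ ((3 : ℝ) / 4 - (n : ℝ) / 2)) ^ 2) := by
          refine Real.sqrt_le_sqrt ?_
          calc _ ≤ ∫ k : ℝ, c * G ((k - (η + α)) / s) :=
                integral_mono_of_nonneg (.of_forall fun k => by positivity)
                  (hint.const_mul c) (.of_forall hpt)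
            _ = _ := by rw [integral_const_mul, hval, hpow, hc]; ring
      _ = _ := by rw [Real.sqrt_mul' _ (sq_nonneg _), Real.sqrt_sq (by positivity)]
  · rintro hbar ⟨h0, -⟩
    set a := H.leadingCoeff * α ^ j * hbar ^ (-(j : ℝ) / 2) with ha
    have habs : |H.leadingCoeff| * α ^ j * hbar ^ (-(j : ℝ) / 2) = |a| := by
      rw [ha, abs_mul, abs_mul, abs_of_pos (pow_pos hα j), abs_of_pos (Real.rpow_pos_of_pos h0 _)]
    have hsq (k : ℝ) : |a * Real.exp (-(k - η - α) ^ 2 / (2 * hbar))| ^ 2 =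
        a ^ 2 * Real.exp (-(1 / hbar) * (k - (η + α)) ^ 2) := by
      rw [sq_abs, mul_pow, ← Real.exp_nat_mul]
      congr 2
      push_cast
      field_simp
      ring
    simp_rw [hsq]
    rw [integral_const_mul,
      integral_sub_right_eq_self (fun k => Real.exp (-(1 / hbar) * k ^ 2)), integral_gaussian,
      habs, ← Real.sqrt_eq_rpow, Real.sqrt_mul (sq_nonneg a), Real.sqrt_sq_eq_abs, div_div_eq_mul_div,
      div_one, Real.sqrt_eq_rpow, Real.sqrt_eq_rpow, ← Real.rpow_mul (by positivity)]
    norm_num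
end

section
/- Let ν>0, c₀>0, C₀>0, E∈ℝ. Let V:[1,∞)→ℝ be C² with V(x) ≤ E−c₀, |V'(x)| ≤ C₀x^{−2−ν}, and |V''(x)| ≤ C₀x^{−3−ν} for all x≥1; set p(x)=√(2(E−V(x))) and θ(x)=∫_1^x p(y)dy. For ħ∈(0,1], let (c₁,c₂):[1,∞)→ℂ² be a bounded differentiable solution of c₁'(x) = (p'(x)/(2p(x)))·e^{2iθ(x)/ħ}·c₂(x), c₂'(x) = (p'(x)/(2p(x)))·e^{−2iθ(x)/ħ}·c₁(x) satisfying lim_{x→∞}c₁(x)=0 and lim_{x→∞}c₂(x)=1. Then there is a constant C, independent of ħ∈(0,1], such that for all x≥1: |c₂(x) − 1 − iħ·∫_x^∞ (p'(y))²/(8·p(y)³) dy| ≤ C·ħ²·x^{−1−ν}. -/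
open Complex MeasureTheory Set Filter intervalIntegral

/-- The primitive based at `a` of a function continuous on `[a, ∞)` is differentiable
within `[a, ∞)`, including at the endpoint. -/
lemma hasDerivWithinAt_Ici_integral {f : ℝ → ℝ} {a x : ℝ} (hf : ContinuousOn f (Ici a))
    (hx : a ≤ x) :
    HasDerivWithinAt (fun u => ∫ y in a..u, f y) (f x) (Ici a) x := by
  have hc : Continuous (fun y => f (max a y)) :=
    hf.comp_continuous (by fun_prop) fun y => le_max_left a y
  have hd := (hc.integral_hasStrictDerivAt a x).hasDerivAt.hasDerivWithinAt (s := Ici a)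
  have heq : ∀ u ∈ Ici a, ∫ y in a..u, f y = ∫ y in a..u, f (max a y) := fun u hu =>
    intervalIntegral.integral_congr fun y hy => by
      rw [uIcc_of_le hu] at hy
      simp only [max_eq_right hy.1]
  simpa only [max_eq_right hx] using hd.congr heq (heq x hx)

lemma hasDerivAt_rpow_neg_one_sub {ν x : ℝ} (hx : 0 < x) :
    HasDerivAt (fun y : ℝ => y ^ (-1 - ν)) (-(1 + ν) * x ^ (-2 - ν)) x := by
  convert Real.hasDerivAt_rpow_const (p := -1 - ν) (Or.inl hx.ne') using 2
  · ring
  · ring_nf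

lemma tendsto_rpow_neg_one_sub {ν : ℝ} (hν : 0 < ν) :
    Tendsto (fun y : ℝ => y ^ (-1 - ν)) atTop (nhds 0) := by
  have := tendsto_rpow_neg_atTop (y := 1 + ν) (by linarith)
  simpa only [neg_add'] using this

/-- A function tending to `0` whose derivative is `O(x^{-2-ν})` is `O(x^{-1-ν})`, with the same
constant. -/
lemma norm_le_of_deriv_le_rpow {ν A : ℝ} (hν : 0 < ν) (hA : 0 ≤ A) {F F' : ℝ → ℂ}
    (hF : ∀ x ≥ (1 : ℝ), HasDerivWithinAt F (F' x) (Ici 1) x)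
    (hb : ∀ x ≥ (1 : ℝ), ‖F' x‖ ≤ A * x ^ (-2 - ν))
    (hlim : Tendsto F atTop (nhds 0)) {x : ℝ} (hx : 1 ≤ x) :
    ‖F x‖ ≤ A * x ^ (-1 - ν) := by
  have key : ∀ y ≥ x, ‖F y - F x‖ ≤ A * x ^ (-1 - ν) := by
    intro y hy
    have hB := image_norm_le_of_norm_deriv_right_le_deriv_boundary'
      (f := fun t => F t - F x) (f' := F') (a := x) (b := y)
      (B := fun t => A * (x ^ (-1 - ν) - t ^ (-1 - ν)))
      (B' := fun t => A * (-(-(1 + ν) * t ^ (-2 - ν))))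
      (fun t ht => ((hF t (hx.trans ht.1)).continuousWithinAt.mono
        fun u hu => hx.trans hu.1).sub continuousWithinAt_const)
      (fun t ht => ((hF t (hx.trans ht.1)).mono
        (Ici_subset_Ici.2 (hx.trans ht.1))).sub_const _)
      (by simp)
      (fun t ht => (((hasDerivAt_rpow_neg_one_sub
        (by linarith [ht.1])).const_sub _).const_mul A).continuousAt.continuousWithinAt)
      (fun t ht => (((hasDerivAt_rpow_neg_one_sub
        (by linarith [ht.1])).const_sub _).const_mul A).hasDerivWithinAt)
      (fun t ht => by
        have ht1 : 1 ≤ t := hx.trans ht.1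
        refine (hb t ht1).trans (mul_le_mul_of_nonneg_left ?_ hA)
        have := Real.rpow_nonneg (show (0 : ℝ) ≤ t by linarith) (-2 - ν)
        nlinarith)
      (right_mem_Icc.2 hy)
    refine hB.trans (mul_le_mul_of_nonneg_left ?_ hA)
    have := Real.rpow_nonneg (show (0 : ℝ) ≤ y by linarith) (-1 - ν)
    linarith
  have hl : Tendsto (fun y => ‖F y - F x‖) atTop (nhds ‖0 - F x‖) :=
    (hlim.sub_const _).norm
  have := le_of_tendsto hl (eventually_atTop.2 ⟨x, key⟩)
  simpa using this

/-- Grönwall bound from infinity for an off-diagonal `2 × 2` system with unimodular phases. -/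
lemma norm_sq_add_norm_sq_le {ν K : ℝ} (hν : 0 < ν) (hK : 0 ≤ K) {q : ℝ → ℝ}
    {e f u v : ℝ → ℂ} (hq : ∀ x ≥ (1 : ℝ), |q x| ≤ K * x ^ (-2 - ν))
    (hen : ∀ x, ‖e x‖ = 1) (hfn : ∀ x, ‖f x‖ = 1)
    (hu : ∀ x ≥ (1 : ℝ), HasDerivWithinAt u ((q x : ℂ) * e x * v x) (Ici 1) x)
    (hv : ∀ x ≥ (1 : ℝ), HasDerivWithinAt v ((q x : ℂ) * f x * u x) (Ici 1) x)
    (hu0 : Tendsto u atTop (nhds 0)) (hv1 : Tendsto v atTop (nhds 1))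
    {x : ℝ} (hx : 1 ≤ x) :
    ‖u x‖ ^ 2 + ‖v x‖ ^ 2 ≤ Real.exp (2 * K) := by
  set G : ℝ → ℝ := fun y =>
    (‖u y‖ ^ 2 + ‖v y‖ ^ 2) * Real.exp (-(2 * K) * y ^ (-1 - ν)) with hG
  have hd : ∀ y ≥ (1 : ℝ), HasDerivWithinAt G _ (Ici 1) y := fun y hy =>
    ((hu y hy).norm_sq.add (hv y hy).norm_sq).mul
      (((hasDerivAt_rpow_neg_one_sub (ν := ν) (by linarith)).const_mul
        (-(2 * K))).exp.hasDerivWithinAt)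
  have hmono : MonotoneOn G (Ici 1) := by
    refine monotoneOn_of_hasDerivWithinAt_nonneg (convex_Ici 1)
      (fun y hy => (hd y hy).continuousWithinAt)
      (fun y hy => (hd y (interior_subset hy)).mono interior_subset) ?_
    intro y hy
    have hy1 : (1 : ℝ) ≤ y := interior_subset hy
    have hw := Real.rpow_nonneg (show (0 : ℝ) ≤ y by linarith) (-2 - ν)
    have h1 := neg_le_of_abs_le (abs_real_inner_le_norm (u y) ((q y : ℂ) * e y * v y))
    have h2 := neg_le_of_abs_le (abs_real_inner_le_norm (v y) ((q y : ℂ) * f y * u y))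
    simp only [norm_mul, hen, hfn, mul_one, Complex.norm_real, Real.norm_eq_abs] at h1 h2
    have h3 : |q y| * (2 * (‖u y‖ * ‖v y‖)) ≤
        K * y ^ (-2 - ν) * (‖u y‖ ^ 2 + ‖v y‖ ^ 2) :=
      mul_le_mul (hq y hy1) (by nlinarith [sq_nonneg (‖u y‖ - ‖v y‖)]) (by positivity)
        (by positivity)
    have h4 : 0 ≤ K * y ^ (-2 - ν) * (‖u y‖ ^ 2 + ‖v y‖ ^ 2) * ν := by positivity
    have he := Real.exp_pos (-(2 * K) * y ^ (-1 - ν))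
    refine (mul_nonneg he.le (?_ : 0 ≤ 2 * inner ℝ (u y) ((q y : ℂ) * e y * v y)
      + 2 * inner ℝ (v y) ((q y : ℂ) * f y * u y)
      + 2 * K * ((1 + ν) * y ^ (-2 - ν)) * (‖u y‖ ^ 2 + ‖v y‖ ^ 2))).trans_eq ?_
    · nlinarith
    · simp only [Pi.add_apply]
      ring
  have hlim : Tendsto G atTop (nhds 1) := by
    have h := ((hu0.norm.pow 2).add (hv1.norm.pow 2)).mul
      ((tendsto_rpow_neg_one_sub hν).const_mul (-(2 * K))).rexp
    simpa [hG] using h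
  have hG1 : G x ≤ 1 := ge_of_tendsto hlim
    (eventually_atTop.2 ⟨x, fun y hy => hmono hx (hx.trans hy) hy⟩)
  have hpow : x ^ (-1 - ν) ≤ 1 := Real.rpow_le_one_of_one_le_of_nonpos hx (by linarith)
  have hE : Real.exp (2 * K) * Real.exp (-(2 * K) * x ^ (-1 - ν)) ≥ 1 := by
    rw [← Real.exp_add, ge_iff_le, Real.one_le_exp_iff]
    nlinarith
  exact le_of_mul_le_mul_right (hG1.trans hE) (Real.exp_pos _)

/-- Second-order expansion at infinity of the non-decaying component of a `2 × 2` system with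
rapidly oscillating off-diagonal coupling `q = g p`. -/
lemma norm_sub_expansion_le {ν K : ℝ} (hν : 0 < ν) (hK : 0 ≤ K) :
    ∃ C : ℝ, ∀ (p q g g' J : ℝ → ℝ) (e f u v : ℝ → ℂ), ∀ h ∈ Ioc (0 : ℝ) 1,
    (∀ x ≥ (1 : ℝ), q x = g x * p x) →
    (∀ x ≥ (1 : ℝ), |q x| ≤ K * x ^ (-2 - ν)) →
    (∀ x ≥ (1 : ℝ), |g x| ≤ K * x ^ (-2 - ν)) →
    (∀ x ≥ (1 : ℝ), |g' x| ≤ K * x ^ (-2 - ν)) →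
    (∀ x ≥ (1 : ℝ), HasDerivWithinAt g (g' x) (Ici 1) x) →
    (∀ x ≥ (1 : ℝ), HasDerivWithinAt J (-(q x * g x / 2)) (Ici 1) x) →
    Tendsto J atTop (nhds 0) →
    (∀ x, ‖e x‖ = 1) → (∀ x, ‖f x‖ = 1) → (∀ x, f x * e x = 1) →
    (∀ x ≥ (1 : ℝ), HasDerivWithinAt e (e x * (2 * I * (p x / h : ℝ))) (Ici 1) x) →
    (∀ x ≥ (1 : ℝ), HasDerivWithinAt f (f x * (-2 * I * (p x / h : ℝ))) (Ici 1) x) →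
    (∀ x ≥ (1 : ℝ), HasDerivWithinAt u ((q x : ℂ) * e x * v x) (Ici 1) x) →
    (∀ x ≥ (1 : ℝ), HasDerivWithinAt v ((q x : ℂ) * f x * u x) (Ici 1) x) →
    Tendsto u atTop (nhds 0) → Tendsto v atTop (nhds 1) →
    ∀ x ≥ (1 : ℝ), ‖v x - 1 - I * (h : ℂ) * (J x : ℂ)‖ ≤ C * h ^ 2 * x ^ (-1 - ν) := by
  set M := Real.exp K with hM
  set A := M * (K + K ^ 2) with hAdef
  set B := K * A + K ^ 2 * M with hBdef
  have hM0 : 0 ≤ M := (Real.exp_pos K).le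
  have hA0 : 0 ≤ A := by positivity
  have hB0 : 0 ≤ B := by positivity
  refine ⟨(K ^ 2 * B + K * A + K * A) + K * A, ?_⟩
  intro p q g g' J e f u v h ⟨hh0, hh1⟩ hqg hq hg hg' hgd hJd hJ0 hen hfn hfe hed hfd hu hv hu0
    hv1
  have hhC : (h : ℂ) ≠ 0 := by exact_mod_cast hh0.ne'
  have hw0 : ∀ x ≥ (1 : ℝ), 0 ≤ x ^ (-2 - ν) := fun x hx => Real.rpow_nonneg (by linarith) _
  have hw1 : ∀ x ≥ (1 : ℝ), x ^ (-2 - ν) ≤ 1 := fun x hx =>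
    Real.rpow_le_one_of_one_le_of_nonpos hx (by linarith)
  have hW0 : ∀ x ≥ (1 : ℝ), 0 ≤ x ^ (-1 - ν) := fun x hx => Real.rpow_nonneg (by linarith) _
  have hW1 : ∀ x ≥ (1 : ℝ), x ^ (-1 - ν) ≤ 1 := fun x hx =>
    Real.rpow_le_one_of_one_le_of_nonpos hx (by linarith)
  have hgK : ∀ x ≥ (1 : ℝ), |g x| ≤ K := fun x hx =>
    (hg x hx).trans (mul_le_of_le_one_right hK (hw1 x hx))
  have hsq : ∀ x ≥ (1 : ℝ), ‖u x‖ ^ 2 + ‖v x‖ ^ 2 ≤ M ^ 2 := fun x hx => by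
    refine (norm_sq_add_norm_sq_le hν hK hq hen hfn hu hv hu0 hv1 hx).trans_eq ?_
    rw [hM, ← Real.exp_nat_mul]
    norm_num
  have huM : ∀ x ≥ (1 : ℝ), ‖u x‖ ≤ M := fun x hx =>
    abs_le_of_sq_le_sq' (by nlinarith [hsq x hx, sq_nonneg ‖v x‖]) hM0 |>.2
  have hvM : ∀ x ≥ (1 : ℝ), ‖v x‖ ≤ M := fun x hx =>
    abs_le_of_sq_le_sq' (by nlinarith [hsq x hx, sq_nonneg ‖u x‖]) hM0 |>.2
  have hg0 : Tendsto (fun x => (g x : ℂ)) atTop (nhds 0) := by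
    refine squeeze_zero_norm' (a := fun x => K * x ^ (-1 - ν)) ?_
      (by simpa using (tendsto_rpow_neg_one_sub hν).const_mul K)
    filter_upwards [eventually_ge_atTop (1 : ℝ)] with x hx
    rw [Complex.norm_real]
    exact (hg x hx).trans (mul_le_mul_of_nonneg_left
      (Real.rpow_le_rpow_of_exponent_le hx (by linarith)) hK)
  set k : ℂ := -I * h / 2 with hk
  have hkn : ‖k‖ = h / 2 := by
    simp [hk, abs_of_pos hh0]
  have hkh : k * (2 * I) / h = 1 := by
    rw [hk]; field_simp; simp [Complex.I_sq]
  -- the remainder of `u` after one integration by parts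
  set S : ℝ → ℂ := fun x => u x - k * (g x * e x * v x) with hS
  have hSd : ∀ x ≥ (1 : ℝ), HasDerivWithinAt S
      (-k * (g' x * e x * v x + g x * q x * u x)) (Ici 1) x := fun x hx => by
    refine ((hu x hx).sub ((((hgd x hx).ofReal_comp.mul (hed x hx)).mul
      (hv x hx)).const_mul k)).congr_deriv ?_
    have h1 : (q x : ℂ) = g x * p x := by exact_mod_cast hqg x hx
    rw [Complex.ofReal_div]
    simp only [Pi.mul_apply]
    linear_combination (e x * v x) * h1 - (g x * p x * e x * v x) * hkh
      - k * g x * q x * u x * hfe x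
  have hSdb : ∀ x ≥ (1 : ℝ), ‖-k * (g' x * e x * v x + g x * q x * u x)‖
      ≤ h * A * x ^ (-2 - ν) := fun x hx => by
    rw [norm_mul, norm_neg, hkn]
    have h1 : ‖(g' x : ℂ) * e x * v x + g x * q x * u x‖
        ≤ (K * x ^ (-2 - ν)) * M + K * (K * x ^ (-2 - ν)) * M := by
      refine (norm_add_le _ _).trans (add_le_add ?_ ?_)
      · simp only [norm_mul, Complex.norm_real, Real.norm_eq_abs, hen, mul_one]
        have := hg' x hx; have := hvM x hx; have := hw0 x hx
        gcongr
      · simp only [norm_mul, Complex.norm_real, Real.norm_eq_abs]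
        have := hgK x hx; have := hq x hx; have := huM x hx; have := hw0 x hx
        gcongr
    calc h / 2 * _ ≤ h * ((K * x ^ (-2 - ν)) * M + K * (K * x ^ (-2 - ν)) * M) :=
          mul_le_mul (by linarith) h1 (norm_nonneg _) hh0.le
      _ = _ := by rw [hAdef]; ring
  have hS0 : Tendsto S atTop (nhds 0) := by
    have h1 : Tendsto (fun x => k * (g x * e x * v x)) atTop (nhds 0) := by
      have h2 : Tendsto (fun x => (g x : ℂ) * e x) atTop (nhds 0) := by
        rw [tendsto_zero_iff_norm_tendsto_zero] at hg0 ⊢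
        simpa only [norm_mul, hen, mul_one] using hg0
      simpa using (h2.mul hv1).const_mul k
    simpa using hu0.sub h1
  have hSb : ∀ x ≥ (1 : ℝ), ‖S x‖ ≤ h * A := fun x hx =>
    (norm_le_of_deriv_le_rpow hν (by positivity) hSd hSdb hS0 hx).trans
      (mul_le_of_le_one_right (by positivity) (hW1 x hx))
  have hvS : ∀ x, (q x : ℂ) * f x * u x = q x * f x * S x + k * q x * g x * v x := fun x => by
    simp only [hS]
    linear_combination (k * q x * g x * v x) * hfe x
  have hvb : ∀ x ≥ (1 : ℝ), ‖v x - 1‖ ≤ h * B := fun x hx => by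
    refine (norm_le_of_deriv_le_rpow (F := fun x => v x - 1) (A := h * B) hν (by positivity)
      (fun y hy => (hv y hy).sub_const 1) (fun y hy => ?_)
      (by simpa using hv1.sub_const 1) hx).trans
      (mul_le_of_le_one_right (by positivity) (hW1 x hx))
    rw [hvS y]
    have h1 := hSb y hy
    have h2 := hgK y hy
    have h3 := hq y hy
    have h4 := hvM y hy
    have h5 := hw0 y hy
    calc _ ≤ ‖(q y : ℂ) * f y * S y‖ + ‖k * q y * g y * v y‖ := norm_add_le _ _
      _ = |q y| * ‖S y‖ + h / 2 * |q y| * |g y| * ‖v y‖ := by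
          simp only [norm_mul, Complex.norm_real, Real.norm_eq_abs, hfn, hkn, mul_one]
      _ ≤ (K * y ^ (-2 - ν)) * (h * A) + h * (K * y ^ (-2 - ν)) * K * M := by
          gcongr
          linarith
      _ = _ := by rw [hBdef]; ring
  -- the remainder of `v` after two integrations by parts
  set T : ℝ → ℂ := fun x => v x - 1 - I * h * J x + k * (g x * f x * S x) with hT
  have hTd : ∀ x ≥ (1 : ℝ), HasDerivWithinAt T
      (k * (q x * g x * (v x - 1) + g' x * f x * S x
        + g x * f x * (-k * (g' x * e x * v x + g x * q x * u x)))) (Ici 1) x := fun x hx => by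
    refine ((((hv x hx).sub_const 1).sub ((hJd x hx).ofReal_comp.const_mul (I * h))).add
      ((((hgd x hx).ofReal_comp.mul (hfd x hx)).mul (hSd x hx)).const_mul k)).congr_deriv ?_
    have h1 : (q x : ℂ) = g x * p x := by exact_mod_cast hqg x hx
    rw [hvS x]
    push_cast
    simp only [Pi.mul_apply]
    have h2 : I * h = -2 * k := by rw [hk]; ring
    linear_combination (f x * S x) * h1 - (g x * p x * f x * S x) * hkh
      + (q x * g x / 2) * h2
  have hTdb : ∀ x ≥ (1 : ℝ), ‖k * (q x * g x * (v x - 1) + g' x * f x * S x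
      + g x * f x * (-k * (g' x * e x * v x + g x * q x * u x)))‖
      ≤ h ^ 2 * (K ^ 2 * B + K * A + K * A) * x ^ (-2 - ν) := fun x hx => by
    have h0 := hvb x hx
    have h1 := hSb x hx
    have h2 := hgK x hx
    have h3 := hq x hx
    have h4 := hg' x hx
    have h5 := hw0 x hx
    have h6 := hSdb x hx
    rw [norm_mul, hkn]
    have hsum : ‖(q x : ℂ) * g x * (v x - 1) + g' x * f x * S x
        + g x * f x * (-k * (g' x * e x * v x + g x * q x * u x))‖
        ≤ (K * x ^ (-2 - ν)) * K * (h * B) + (K * x ^ (-2 - ν)) * (h * A)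
          + K * (h * A * x ^ (-2 - ν)) := by
      refine norm_add₃_le.trans (add_le_add (add_le_add ?_ ?_) ?_)
      · simp only [norm_mul, Complex.norm_real, Real.norm_eq_abs]
        gcongr
      · simp only [norm_mul, Complex.norm_real, Real.norm_eq_abs, hfn, mul_one]
        gcongr
      · rw [norm_mul, norm_mul, hfn, mul_one, Complex.norm_real, Real.norm_eq_abs]
        gcongr
    calc h / 2 * _ ≤ h * _ := mul_le_mul (by linarith) hsum (norm_nonneg _) hh0.le
      _ = _ := by ring
  have hT0 : Tendsto T atTop (nhds 0) := by
    have h1 : Tendsto (fun x => k * (g x * f x * S x)) atTop (nhds 0) := by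
      have h2 : Tendsto (fun x => (g x : ℂ) * f x) atTop (nhds 0) := by
        rw [tendsto_zero_iff_norm_tendsto_zero] at hg0 ⊢
        simpa only [norm_mul, hfn, mul_one] using hg0
      simpa using (h2.mul hS0).const_mul k
    have h3 : Tendsto (fun x => (J x : ℂ)) atTop (nhds 0) :=
      (Complex.continuous_ofReal.tendsto' 0 0 (by simp)).comp hJ0
    simpa using ((hv1.sub_const 1).sub (h3.const_mul (I * h))).add h1
  intro x hx
  have hTx := norm_le_of_deriv_le_rpow hν (by positivity) hTd hTdb hT0 hx
  have hcorr : ‖k * (g x * f x * S x)‖ ≤ h * ((K * x ^ (-1 - ν)) * (h * A)) := by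
    have h1 := hSb x hx
    have h2 : |g x| ≤ K * x ^ (-1 - ν) := (hg x hx).trans (mul_le_mul_of_nonneg_left
      (Real.rpow_le_rpow_of_exponent_le hx (by linarith)) hK)
    have h3 := hW0 x hx
    simp only [norm_mul, Complex.norm_real, Real.norm_eq_abs, hfn, hkn, mul_one]
    gcongr
    linarith
  calc ‖v x - 1 - I * h * J x‖ = ‖T x - k * (g x * f x * S x)‖ := by simp [hT]
    _ ≤ ‖T x‖ + ‖k * (g x * f x * S x)‖ := norm_sub_le _ _
    _ ≤ _ := add_le_add hTx hcorr
    _ = _ := by ring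

/-- Next-to-leading order expansion of the WKB coefficient `c₂ = c^a` on the
right of the barrier: for the system
`c₁' = (p'/(2p)) e^{2iθ/ħ} c₂`, `c₂' = (p'/(2p)) e^{-2iθ/ħ} c₁` with boundary
conditions `c₁(∞) = 0`, `c₂(∞) = 1`, one has
`c₂(x) = 1 + iħ ∫_x^∞ (p')²/(8p³) + O(ħ² x^{-1-ν})`, uniformly in `ħ ∈ (0,1]`. -/
theorem wkb_coefficient_expansion
    (ν : ℝ) (hν : 0 < ν) (c₀ C₀ : ℝ) (hc₀ : 0 < c₀) (hC₀ : 0 < C₀) (E : ℝ)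
    (V V' V'' : ℝ → ℝ)
    (hV : ∀ x ≥ (1 : ℝ), HasDerivWithinAt V (V' x) (Ici 1) x)
    (hV' : ∀ x ≥ (1 : ℝ), HasDerivWithinAt V' (V'' x) (Ici 1) x)
    (hV''cont : ContinuousOn V'' (Ici 1))
    (hVb : ∀ x ≥ (1 : ℝ), V x ≤ E - c₀)
    (hV'b : ∀ x ≥ (1 : ℝ), |V' x| ≤ C₀ * x ^ (-2 - ν))
    (hV''b : ∀ x ≥ (1 : ℝ), |V'' x| ≤ C₀ * x ^ (-3 - ν))
    (p p' : ℝ → ℝ) (hp : ∀ x, p x = Real.sqrt (2 * (E - V x)))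
    (hpd : ∀ x ≥ (1 : ℝ), HasDerivWithinAt p (p' x) (Ici 1) x)
    (θ : ℝ → ℝ) (hθ : ∀ x, θ x = ∫ y in (1 : ℝ)..x, p y)
    (c₁ c₂ : ℝ → ℝ → ℂ)
    (hode₁ : ∀ hbar ∈ Ioc (0 : ℝ) 1, ∀ x ≥ (1 : ℝ),
      HasDerivWithinAt (c₁ hbar)
        (((p' x / (2 * p x) : ℝ) : ℂ)
          * Complex.exp (2 * Complex.I * ((θ x / hbar : ℝ) : ℂ)) * c₂ hbar x) (Ici 1) x)
    (hode₂ : ∀ hbar ∈ Ioc (0 : ℝ) 1, ∀ x ≥ (1 : ℝ),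
      HasDerivWithinAt (c₂ hbar)
        (((p' x / (2 * p x) : ℝ) : ℂ)
          * Complex.exp (-2 * Complex.I * ((θ x / hbar : ℝ) : ℂ)) * c₁ hbar x) (Ici 1) x)
    (hbdd : ∀ hbar ∈ Ioc (0 : ℝ) 1, ∃ B : ℝ, ∀ x ≥ (1 : ℝ),
      ‖c₁ hbar x‖ ≤ B ∧ ‖c₂ hbar x‖ ≤ B)
    (hlim₁ : ∀ hbar ∈ Ioc (0 : ℝ) 1, Tendsto (c₁ hbar) atTop (nhds 0))
    (hlim₂ : ∀ hbar ∈ Ioc (0 : ℝ) 1, Tendsto (c₂ hbar) atTop (nhds 1)) :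
    ∃ C : ℝ, ∀ hbar ∈ Ioc (0 : ℝ) 1, ∀ x ≥ (1 : ℝ),
      ‖c₂ hbar x - 1 - Complex.I * (hbar : ℂ)
          * (((∫ y in Ioi x, (p' y) ^ 2 / (8 * (p y) ^ 3)) : ℝ) : ℂ)‖
        ≤ C * hbar ^ 2 * x ^ (-1 - ν) := by
  set m := Real.sqrt (2 * c₀) with hm
  have hm0 : 0 < m := Real.sqrt_pos.2 (by linarith)
  have hpm : ∀ x ≥ (1 : ℝ), m ≤ p x := fun x hx => by
    rw [hp x]
    exact Real.sqrt_le_sqrt (by linarith [hVb x hx])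
  have hp0 : ∀ x ≥ (1 : ℝ), 0 < p x := fun x hx => hm0.trans_le (hpm x hx)
  have hpV : ∀ x ≥ (1 : ℝ), p' x = -V' x / p x := fun x hx => by
    have h1 : HasDerivWithinAt (fun y => p y ^ 2) (2 * p x * p' x) (Ici 1) x :=
      ((hpd x hx).pow 2).congr_deriv (by simp)
    have h2 : HasDerivWithinAt (fun y => p y ^ 2) (2 * -V' x) (Ici 1) x := by
      refine (((hV x hx).const_sub E).const_mul 2).congr_of_mem (fun y hy => ?_) hx
      rw [hp y, Real.sq_sqrt (by linarith [hVb y hy])]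
    have h3 := (uniqueDiffOn_Ici (1 : ℝ) x hx).eq_deriv _ h1 h2
    rw [eq_div_iff (hp0 x hx).ne']
    linarith
  have hw0 : ∀ x ≥ (1 : ℝ), 0 ≤ x ^ (-2 - ν) := fun x hx => Real.rpow_nonneg (by linarith) _
  have hw1 : ∀ x ≥ (1 : ℝ), x ^ (-2 - ν) ≤ 1 := fun x hx =>
    Real.rpow_le_one_of_one_le_of_nonpos hx (by linarith)
  have hV''w : ∀ x ≥ (1 : ℝ), |V'' x| ≤ C₀ * x ^ (-2 - ν) := fun x hx =>
    (hV''b x hx).trans (mul_le_mul_of_nonneg_left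
      (Real.rpow_le_rpow_of_exponent_le hx (by linarith)) hC₀.le)
  set q : ℝ → ℝ := fun x => p' x / (2 * p x) with hq
  set g : ℝ → ℝ := fun x => -V' x / (2 * p x ^ 3) with hg
  set g' : ℝ → ℝ := fun x => -V'' x / (2 * p x ^ 3) - 3 * (V' x * V' x) / (2 * p x ^ 5) with hg'
  set K₁ := C₀ / (2 * m ^ 2) with hK₁
  set K₂ := C₀ / (2 * m ^ 3) with hK₂
  set K₃ := 3 * (C₀ * C₀) / (2 * m ^ 5) with hK₃
  have hK₁0 : 0 ≤ K₁ := by positivity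
  have hK₂0 : 0 ≤ K₂ := by positivity
  have hK₃0 : 0 ≤ K₃ := by positivity
  set K := K₁ + K₂ + K₃ with hK
  have hqV : ∀ x ≥ (1 : ℝ), q x = -V' x / (2 * p x ^ 2) := fun x hx => by
    have := hp0 x hx
    simp only [hq, hpV x hx]
    field_simp
  have hqb : ∀ x ≥ (1 : ℝ), |q x| ≤ K * x ^ (-2 - ν) := fun x hx => by
    have h0 := hw0 x hx
    have h1 := hpm x hx
    have h2 := hp0 x hx
    have h3 := hV'b x hx
    rw [hqV x hx, abs_div, abs_neg, abs_of_pos (show 0 < 2 * p x ^ 2 by positivity)]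
    calc |V' x| / (2 * p x ^ 2) ≤ C₀ * x ^ (-2 - ν) / (2 * m ^ 2) := by gcongr
      _ = K₁ * x ^ (-2 - ν) := by rw [hK₁]; ring
      _ ≤ K * x ^ (-2 - ν) := mul_le_mul_of_nonneg_right (by linarith) h0
  have hVp : ∀ {W : ℝ} {x : ℝ}, 1 ≤ x → |W| ≤ C₀ * x ^ (-2 - ν) →
      |-W / (2 * p x ^ 3)| ≤ K₂ * x ^ (-2 - ν) := fun {W x} hx hW => by
    have h0 := hw0 x hx
    have h1 := hpm x hx
    have h2 := hp0 x hx
    rw [abs_div, abs_neg, abs_of_pos (show 0 < 2 * p x ^ 3 by positivity)]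
    calc |W| / (2 * p x ^ 3) ≤ C₀ * x ^ (-2 - ν) / (2 * m ^ 3) := by gcongr
      _ = K₂ * x ^ (-2 - ν) := by rw [hK₂]; ring
  have hgb : ∀ x ≥ (1 : ℝ), |g x| ≤ K * x ^ (-2 - ν) := fun x hx =>
    (hVp hx (hV'b x hx)).trans (mul_le_mul_of_nonneg_right (by linarith) (hw0 x hx))
  have hg'b : ∀ x ≥ (1 : ℝ), |g' x| ≤ K * x ^ (-2 - ν) := fun x hx => by
    have h0 := hw0 x hx
    have h1 := hpm x hx
    have h2 := hp0 x hx
    have h3 := hV'b x hx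
    have h4 : |V' x| ≤ C₀ := h3.trans (mul_le_of_le_one_right hC₀.le (hw1 x hx))
    have h5 : |3 * (V' x * V' x) / (2 * p x ^ 5)| ≤ K₃ * x ^ (-2 - ν) := by
      rw [abs_div, abs_of_pos (show 0 < 2 * p x ^ 5 by positivity), abs_mul, abs_mul,
        abs_of_pos (show (0 : ℝ) < 3 by norm_num)]
      calc 3 * (|V' x| * |V' x|) / (2 * p x ^ 5)
          ≤ 3 * (C₀ * (C₀ * x ^ (-2 - ν))) / (2 * m ^ 5) := by gcongr
        _ = K₃ * x ^ (-2 - ν) := by rw [hK₃]; ring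
    calc |g' x| ≤ K₂ * x ^ (-2 - ν) + K₃ * x ^ (-2 - ν) :=
          (abs_sub _ _).trans (add_le_add (hVp hx (hV''w x hx)) h5)
      _ ≤ K * x ^ (-2 - ν) := by rw [← add_mul]; exact mul_le_mul_of_nonneg_right (by linarith) h0
  have hgd : ∀ x ≥ (1 : ℝ), HasDerivWithinAt g (g' x) (Ici 1) x := fun x hx => by
    have h2 := hp0 x hx
    refine ((hV' x hx).neg.div (((hpd x hx).pow 3).const_mul 2)
      (mul_pos two_pos (pow_pos h2 3)).ne').congr_deriv ?_
    simp only [hg', hpV x hx, Pi.neg_apply, Pi.pow_apply]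
    field_simp
    ring
  have hqg : ∀ x ≥ (1 : ℝ), q x = g x * p x := fun x hx => by
    have := hp0 x hx
    rw [hqV x hx]
    simp only [hg]
    field_simp
  have hF : ∀ x ≥ (1 : ℝ), p' x ^ 2 / (8 * p x ^ 3) = q x * g x / 2 := fun x hx => by
    have := hp0 x hx
    rw [hqV x hx, hpV x hx]
    simp only [hg]
    field_simp
    ring
  have hpc : ContinuousOn p (Ici 1) := fun x hx => (hpd x hx).continuousWithinAt
  have hFc : ContinuousOn (fun x => p' x ^ 2 / (8 * p x ^ 3)) (Ici 1) := by
    have hgc : ContinuousOn g (Ici 1) := fun x hx => (hgd x hx).continuousWithinAt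
    refine (((hgc.mul hpc).mul hgc).div_const 2).congr fun x hx => ?_
    rw [hF x hx, hqg x hx]
    rfl
  have hFi : IntegrableOn (fun x => p' x ^ 2 / (8 * p x ^ 3)) (Ioi 1) := by
    have hdom : IntegrableOn (fun x : ℝ => K * K * x ^ (-2 - ν)) (Ioi 1) :=
      (integrableOn_Ioi_rpow_of_lt (by linarith) one_pos).const_mul _
    refine hdom.mono' ((hFc.mono Ioi_subset_Ici_self).aestronglyMeasurable measurableSet_Ioi) ?_
    refine (ae_restrict_iff' measurableSet_Ioi).2 (Eventually.of_forall fun x hx => ?_)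
    have hx1 : (1 : ℝ) ≤ x := (mem_Ioi.1 hx).le
    have h0 := hw0 x hx1
    have h1 := hqb x hx1
    have h2 : |g x| ≤ K :=
      (hgb x hx1).trans (mul_le_of_le_one_right (by positivity) (hw1 x hx1))
    rw [hF x hx1, Real.norm_eq_abs, abs_div, abs_mul, abs_two]
    have h3 : |q x| * |g x| ≤ K * x ^ (-2 - ν) * K := by gcongr
    nlinarith [abs_nonneg (q x), abs_nonneg (g x), mul_nonneg (abs_nonneg (q x)) (abs_nonneg (g x))]
  set J : ℝ → ℝ := fun x => ∫ y in Ioi x, p' y ^ 2 / (8 * p y ^ 3) with hJ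
  have hJeq : ∀ x ≥ (1 : ℝ), J x = J 1 - ∫ y in (1 : ℝ)..x, p' y ^ 2 / (8 * p y ^ 3) :=
    fun x hx => by
      rw [eq_sub_iff_add_eq', hJ]
      exact intervalIntegral.integral_interval_add_Ioi hFi (hFi.mono_set (Ioi_subset_Ioi hx))
  have hJd : ∀ x ≥ (1 : ℝ), HasDerivWithinAt J (-(q x * g x / 2)) (Ici 1) x := fun x hx => by
    rw [← hF x hx]
    exact ((hasDerivWithinAt_Ici_integral hFc hx).const_sub (J 1)).congr_of_mem hJeq hx
  have hJ0 : Tendsto J atTop (nhds 0) := by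
    have h1 := (intervalIntegral_tendsto_integral_Ioi 1 hFi tendsto_id).const_sub (J 1)
    rw [sub_self] at h1
    exact h1.congr' ((eventually_ge_atTop 1).mono fun x hx => (hJeq x hx).symm)
  have hθd : ∀ hbar : ℝ, ∀ x ≥ (1 : ℝ), HasDerivWithinAt
      (fun y => ((θ y / hbar : ℝ) : ℂ)) ((p x / hbar : ℝ) : ℂ) (Ici 1) x := fun hbar x hx => by
    have h1 : HasDerivWithinAt θ (p x) (Ici 1) x := by
      rw [funext hθ]
      exact hasDerivWithinAt_Ici_integral hpc hx
    exact (h1.div_const hbar).ofReal_comp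
  obtain ⟨C, hC⟩ := norm_sub_expansion_le hν (show 0 ≤ K by positivity)
  refine ⟨C, fun hbar hh => ?_⟩
  refine hC p q g g' J (fun x => Complex.exp (2 * I * ((θ x / hbar : ℝ) : ℂ)))
    (fun x => Complex.exp (-2 * I * ((θ x / hbar : ℝ) : ℂ))) (c₁ hbar) (c₂ hbar) hbar hh
    hqg hqb hgb hg'b hgd hJd hJ0 (fun x => ?_) (fun x => ?_) (fun x => ?_)
    (fun x hx => ((hθd hbar x hx).const_mul (2 * I)).cexp)
    (fun x hx => ((hθd hbar x hx).const_mul (-2 * I)).cexp)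
    (hode₁ hbar hh) (hode₂ hbar hh) (hlim₁ hbar hh) (hlim₂ hbar hh)
  · rw [Complex.norm_exp]
    simp
  · rw [Complex.norm_exp]
    simp
  · rw [← Complex.exp_add, Complex.exp_eq_one_iff]
    exact ⟨0, by push_cast; ring⟩
end
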